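/- For every τ in the complex upper half-plane, ( θ[1/5,1/5](τ)²·θ[1/5,3/5](τ) − ζ₅⁴·θ[1/5,9/5](τ)²·θ[1/5,7/5](τ) )·( ζ₅·θ[3/5,7/5](τ)²·θ[3/5,1/5](τ) − ζ₅·θ[3/5,3/5](τ)²·θ[3/5,9/5](τ) ) = ( θ[3/5,1/5](τ)²·θ[3/5,3/5](τ) − ζ₅²·θ[3/5,9/5](τ)²·θ[3/5,7/5](τ) )·( ζ₅²·θ[1/5,7/5](τ)²·θ[1/5,1/5](τ) − ζ₅²·θ[1/5,3/5](τ)²·θ[1/5,9/5](τ) ). -/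

import Mathlib

open Complex

/-- The theta constant with characteristic `[ε; ε']`:
`θ[ε,ε'](τ) = ∑_{n ∈ ℤ} exp(2πi((1/2)(n+ε/2)²τ + (n+ε/2)(ε'/2)))`. -/
noncomputable def θ (ε ε' : ℝ) (τ : ℂ) : ℂ :=
  ∑' n : ℤ, Complex.exp (2 * Real.pi * Complex.I *
    ((1 / 2) * ((n : ℂ) + (ε : ℂ) / 2) ^ 2 * τ + ((n : ℂ) + (ε : ℂ) / 2) * ((ε' : ℂ) / 2)))

/-- `ζ₅ = exp(2πi/5)`. -/
noncomputable def ζ₅ : ℂ := Complex.exp (2 * Real.pi * Complex.I / 5)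

lemma summable_theta_term (ε ε' : ℝ) {τ : ℂ} (hτ : 0 < τ.im) :
    Summable fun n : ℤ ↦ Complex.exp (2 * Real.pi * Complex.I *
      ((1 / 2) * ((n : ℂ) + (ε : ℂ) / 2) ^ 2 * τ + ((n : ℂ) + (ε : ℂ) / 2) * ((ε' : ℂ) / 2))) := by
  refine (((summable_jacobiTheta₂_term_iff (ε * τ / 2 + ε' / 2) τ).mpr hτ).mul_left
    (Complex.exp (Real.pi * Complex.I * (ε ^ 2 * τ / 4 + ε * ε' / 2)))).congr fun n ↦ ?_
  rw [jacobiTheta₂_term, ← Complex.exp_add]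
  congr 1
  ring

/-- The bijection of `ℤ × ℤ ⊕ ℤ × ℤ` with `ℤ × ℤ` recovering `(n, m)` from the halves of
`n + m` and `n - m`, according to their common parity. -/
def sumDiffEquiv : (ℤ × ℤ) ⊕ (ℤ × ℤ) ≃ ℤ × ℤ where
  toFun := Sum.elim (fun p ↦ (p.1 + p.2, p.1 - p.2)) (fun p ↦ (p.1 + p.2 + 1, p.1 - p.2))
  invFun q := if (q.1 + q.2) % 2 = 0 then Sum.inl ((q.1 + q.2) / 2, (q.1 - q.2) / 2)
    else Sum.inr ((q.1 + q.2) / 2, (q.1 - q.2) / 2)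
  left_inv := by
    rintro (⟨s, d⟩ | ⟨s, d⟩)
    · have h : (s + d + (s - d)) % 2 = 0 := by omega
      simp only [Sum.elim_inl, h, if_true, Sum.inl.injEq, Prod.mk.injEq]
      omega
    · have h : ¬ (s + d + 1 + (s - d)) % 2 = 0 := by omega
      simp only [Sum.elim_inr, h, if_false, Sum.inr.injEq, Prod.mk.injEq]
      omega
  right_inv := by
    rintro ⟨n, m⟩
    by_cases h : (n + m) % 2 = 0
    · simp only [h, if_true, Sum.elim_inl, Prod.mk.injEq]
      omega
    · simp only [h, if_false, Sum.elim_inr, Prod.mk.injEq]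
      omega

lemma theta_add_mul_theta_sub (a a' b b' : ℝ) {τ : ℂ} (hτ : 0 < τ.im) :
    θ (a + b) (a' + b') τ * θ (a - b) (a' - b') τ =
      θ a (2 * a') (2 * τ) * θ b (2 * b') (2 * τ) +
        θ (a + 1) (2 * a') (2 * τ) * θ (b + 1) (2 * b') (2 * τ) := by
  have hτ₂ : 0 < (2 * τ).im := by simpa using hτ
  have hsum (ε₁ ε₁' ε₂ ε₂' : ℝ) {σ : ℂ} (hσ : 0 < σ.im) :=
    (summable_mul_of_summable_norm (summable_theta_term ε₁ ε₁' hσ).norm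
      (summable_theta_term ε₂ ε₂' hσ).norm).hasSum
  have hprod (ε₁ ε₁' ε₂ ε₂' : ℝ) {σ : ℂ} (hσ : 0 < σ.im) :=
    tsum_mul_tsum_of_summable_norm (summable_theta_term ε₁ ε₁' hσ).norm
      (summable_theta_term ε₂ ε₂' hσ).norm
  simp only [θ]
  rw [hprod _ _ _ _ hτ, hprod _ _ _ _ hτ₂, hprod _ _ _ _ hτ₂, ← sumDiffEquiv.tsum_eq]
  refine (HasSum.sum ?_ ?_).tsum_eq
  · convert hsum a (2 * a') b (2 * b') hτ₂ using 2 with p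
    simp only [sumDiffEquiv, Equiv.coe_fn_mk, Function.comp_apply, Sum.elim_inl,
      ← Complex.exp_add]
    congr 1
    push_cast
    ring
  · convert hsum (a + 1) (2 * a') (b + 1) (2 * b') hτ₂ using 2 with p
    simp only [sumDiffEquiv, Equiv.coe_fn_mk, Function.comp_apply, Sum.elim_inr,
      ← Complex.exp_add]
    congr 1
    push_cast
    ring

lemma theta_add_two_left (ε ε' : ℝ) (τ : ℂ) : θ (ε + 2) ε' τ = θ ε ε' τ := by
  simp only [θ]
  rw [← (Equiv.addRight (1 : ℤ)).tsum_eq (fun n : ℤ ↦ Complex.exp (2 * Real.pi * Complex.I *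
    ((1 / 2) * ((n : ℂ) + (ε : ℂ) / 2) ^ 2 * τ + ((n : ℂ) + (ε : ℂ) / 2) * ((ε' : ℂ) / 2))))]
  refine tsum_congr fun n ↦ ?_
  simp only [Equiv.coe_addRight]
  congr 1
  push_cast
  ring

lemma theta_add_two_right (ε ε' : ℝ) (τ : ℂ) :
    θ ε (ε' + 2) τ = Complex.exp (Real.pi * Complex.I * ε) * θ ε ε' τ := by
  simp only [θ]
  rw [← tsum_mul_left]
  refine tsum_congr fun n ↦ ?_
  rw [← Complex.exp_add, ← Complex.exp_periodic.int_mul n (_ + _)]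
  congr 1
  push_cast
  ring

lemma theta_neg_neg (ε ε' : ℝ) (τ : ℂ) : θ (-ε) (-ε') τ = θ ε ε' τ := by
  simp only [θ]
  rw [← (Equiv.neg ℤ).tsum_eq]
  refine tsum_congr fun n ↦ ?_
  simp only [Equiv.neg_apply]
  congr 1
  push_cast
  ring

/-- The odd theta function at the point `x τ + y`, up to an exponential factor chosen so that
`oddTheta_three_term` has trivial coefficients. -/
noncomputable def oddTheta (x y : ℝ) (τ : ℂ) : ℂ :=
  Complex.exp (-(Real.pi * Complex.I * x)) * θ (1 + 2 * x) (1 + 2 * y) τ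

lemma exp_pi_I_mul_add_one (z : ℂ) :
    Complex.exp (Real.pi * Complex.I * (1 + z)) = -Complex.exp (Real.pi * Complex.I * z) := by
  rw [mul_add, mul_one, Complex.exp_add, Complex.exp_pi_mul_I, neg_one_mul]

lemma oddTheta_neg (x y : ℝ) (τ : ℂ) : oddTheta (-x) (-y) τ = -oddTheta x y τ := by
  have h : θ (1 + 2 * x) (1 + 2 * y) τ =
      -(Complex.exp (2 * (Real.pi * Complex.I * x)) * θ (1 + 2 * -x) (1 + 2 * -y) τ) := by
    rw [← theta_neg_neg (1 + 2 * -x), ← theta_add_two_left (-_),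
      show 1 + 2 * y = -(1 + 2 * -y) + 2 by ring, theta_add_two_right,
      show -(1 + 2 * -x) + 2 = 1 + 2 * x by ring, ← neg_mul]
    congr 1
    push_cast
    rw [exp_pi_I_mul_add_one]
    congr 2
    ring
  rw [oddTheta, oddTheta, h, mul_neg (Complex.exp _), neg_neg, ← mul_assoc, ← Complex.exp_add]
  congr 2
  push_cast
  ring

lemma oddTheta_add_one_left (x y : ℝ) (τ : ℂ) : oddTheta (x + 1) y τ = -oddTheta x y τ := by
  rw [oddTheta, oddTheta, show 1 + 2 * (x + 1) = 1 + 2 * x + 2 by ring, theta_add_two_left,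
    ← neg_mul (Complex.exp _)]
  congr 1
  push_cast
  rw [show -(Real.pi * Complex.I * (x + 1)) = Real.pi * Complex.I * -x - Real.pi * Complex.I by
    ring, Complex.exp_sub_pi_mul_I]
  congr 2
  ring

lemma oddTheta_add_one_right (x y : ℝ) (τ : ℂ) :
    oddTheta x (y + 1) τ = -(Complex.exp (2 * Real.pi * Complex.I * x) * oddTheta x y τ) := by
  rw [oddTheta, oddTheta, show 1 + 2 * (y + 1) = 1 + 2 * y + 2 by ring, theta_add_two_right]
  push_cast
  rw [exp_pi_I_mul_add_one, show 2 * Real.pi * Complex.I * x = Real.pi * Complex.I * (2 * x) by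
    ring]
  ring

lemma oddTheta_add_mul_oddTheta_sub (x y u v : ℝ) {τ : ℂ} (hτ : 0 < τ.im) :
    oddTheta (x + u) (y + v) τ * oddTheta (x - u) (y - v) τ =
      θ (2 * x) (4 * y) (2 * τ) * θ (1 + 2 * u) (4 * v) (2 * τ) -
        θ (1 + 2 * x) (4 * y) (2 * τ) * θ (2 * u) (4 * v) (2 * τ) := by
  have h := theta_add_mul_theta_sub (1 + 2 * x) (1 + 2 * y) (2 * u) (2 * v) hτ
  rw [show 2 * (1 + 2 * y) = 4 * y + 2 by ring, theta_add_two_right, theta_add_two_right,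
    show 1 + 2 * x + 1 = 2 * x + 2 by ring, theta_add_two_left,
    show 2 * u + 1 = 1 + 2 * u by ring, show 2 * (2 * v) = 4 * v by ring] at h
  push_cast at h
  rw [exp_pi_I_mul_add_one, show Real.pi * Complex.I * (2 * x + 2) =
    Real.pi * Complex.I * (2 * x) + 2 * Real.pi * Complex.I by ring,
    Complex.exp_periodic] at h
  have hexp : Complex.exp (-(Real.pi * Complex.I * (x + u))) *
      Complex.exp (-(Real.pi * Complex.I * (x - u))) * Complex.exp (Real.pi * Complex.I * (2 * x))
      = 1 := by
    rw [← Complex.exp_add, ← Complex.exp_add, ← Complex.exp_zero]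
    congr 1
    ring
  simp only [oddTheta]
  rw [show 1 + 2 * (x + u) = 1 + 2 * x + 2 * u by ring,
    show 1 + 2 * (y + v) = 1 + 2 * y + 2 * v by ring,
    show 1 + 2 * (x - u) = 1 + 2 * x - 2 * u by ring,
    show 1 + 2 * (y - v) = 1 + 2 * y - 2 * v by ring]
  push_cast
  linear_combination Complex.exp (-(Real.pi * Complex.I * (x + u))) *
    Complex.exp (-(Real.pi * Complex.I * (x - u))) * h +
    (θ (2 * x) (4 * y) (2 * τ) * θ (1 + 2 * u) (4 * v) (2 * τ) -
        θ (1 + 2 * x) (4 * y) (2 * τ) * θ (2 * u) (4 * v) (2 * τ)) * hexp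

/-- Weierstrass' three-term relation, specialised to one vanishing argument. -/
lemma oddTheta_three_term (b b' c c' d d' : ℝ) {τ : ℂ} (hτ : 0 < τ.im) :
    oddTheta b b' τ ^ 2 * oddTheta (c + d) (c' + d') τ * oddTheta (c - d) (c' - d') τ +
      oddTheta d d' τ ^ 2 * oddTheta (b + c) (b' + c') τ * oddTheta (b - c) (b' - c') τ =
      oddTheta c c' τ ^ 2 * oddTheta (b + d) (b' + d') τ * oddTheta (b - d) (b' - d') τ := by
  have hsq (x x' : ℝ) : oddTheta x x' τ ^ 2 =
      -(θ 0 0 (2 * τ) * θ (1 + 2 * x) (4 * x') (2 * τ) -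
        θ 1 0 (2 * τ) * θ (2 * x) (4 * x') (2 * τ)) := by
    have h := oddTheta_add_mul_oddTheta_sub 0 0 x x' hτ
    simp only [zero_add, zero_sub, mul_zero, add_zero, oddTheta_neg] at h
    linear_combination -h
  have hcd := oddTheta_add_mul_oddTheta_sub c c' d d' hτ
  have hbc := oddTheta_add_mul_oddTheta_sub b b' c c' hτ
  have hbd := oddTheta_add_mul_oddTheta_sub b b' d d' hτ
  rw [mul_assoc, mul_assoc, mul_assoc, hcd, hbc, hbd, hsq, hsq, hsq]
  ring

/-- The identity between six-fold products that follows from the three-term relation for any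
function with the symmetries of the odd theta function on the `5`-torsion points. -/
lemma sextic_identity_of_three_term {R : Type*} [CommRing R] (ζ : R) (hζ : ζ ^ 5 = 1)
    (K : ℤ → ℤ → R) (hneg : ∀ m n, K (-m) (-n) = -K m n) (hleft : ∀ m n, K (m + 5) n = -K m n)
    (hright : ∀ (m : ℕ) n, K m (n + 5) = -(ζ ^ m * K m n))
    (hK : ∀ b b' c c' d d', K b b' ^ 2 * K (c + d) (c' + d') * K (c - d) (c' - d') +
      K d d' ^ 2 * K (b + c) (b' + c') * K (b - c) (b' - c') =
      K c c' ^ 2 * K (b + d) (b' + d') * K (b - d) (b' - d')) :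
    (K (-2) (-2) ^ 2 * K (-2) (-1) - ζ ^ 4 * K (-2) 2 ^ 2 * K (-2) 1) *
        (ζ * K (-1) 1 ^ 2 * K (-1) (-2) - ζ * K (-1) (-1) ^ 2 * K (-1) 2) =
      (K (-1) (-2) ^ 2 * K (-1) (-1) - ζ ^ 2 * K (-1) 2 ^ 2 * K (-1) 1) *
        (ζ ^ 2 * K (-2) 1 ^ 2 * K (-2) (-2) - ζ ^ 2 * K (-2) (-1) ^ 2 * K (-2) 2) := by
  have r₁ := hK 2 0 2 2 2 (-2)
  have r₂ := hK 0 2 1 (-1) 2 (-1)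
  have r₃ := hK 1 0 1 2 1 (-2)
  have r₄ := hK 0 2 1 1 2 (-1)
  have r₅ := hK 0 2 1 (-1) 2 1
  have r₆ := hK 0 2 1 1 2 1
  have kn1n2 : K (-1) (-2) = -K 1 2 := hneg 1 2
  have kn1n1 : K (-1) (-1) = -K 1 1 := hneg 1 1
  have kn10 : K (-1) 0 = -K 1 0 := hneg 1 0
  have kn11 : K (-1) 1 = -K 1 (-1) := by simpa using hneg 1 (-1)
  have kn12 : K (-1) 2 = -K 1 (-2) := by simpa using hneg 1 (-2)
  have kn2n2 : K (-2) (-2) = -K 2 2 := hneg 2 2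
  have kn2n1 : K (-2) (-1) = -K 2 1 := hneg 2 1
  have kn20 : K (-2) 0 = -K 2 0 := hneg 2 0
  have kn21 : K (-2) 1 = -K 2 (-1) := by simpa using hneg 2 (-1)
  have kn22 : K (-2) 2 = -K 2 (-2) := by simpa using hneg 2 (-2)
  have k0n2 : K 0 (-2) = -K 0 2 := hneg 0 2
  have k04 : K 0 4 = K 0 1 := by simpa [← hneg] using hright 0 (-1)
  have k3n2 : K 3 (-2) = K 2 2 := by simpa [kn2n2] using hleft (-2) (-2)
  have k30 : K 3 0 = K 2 0 := by simpa [kn20] using hleft (-2) 0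
  have k32 : K 3 2 = K 2 (-2) := by simpa [kn22] using hleft (-2) 2
  have k4n2 : K 4 (-2) = K 1 2 := by simpa [kn1n2] using hleft (-1) (-2)
  have k40 : K 4 0 = K 1 0 := by simpa [kn10] using hleft (-1) 0
  have k42 : K 4 2 = K 1 (-2) := by simpa [kn12] using hleft (-1) 2
  have k13 : K 1 3 = -(ζ * K 1 (-2)) := by simpa using hright 1 (-2)
  have k23 : K 2 3 = -(ζ ^ 2 * K 2 (-2)) := by simpa using hright 2 (-2)
  have kn13 : K (-1) 3 = ζ ^ 4 * K 1 2 := by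
    have h := hleft (-1) 3
    have h' := hright 4 (-2)
    norm_num at h h'
    rw [← k4n2, ← neg_neg (K (-1) 3), ← h, h', neg_neg]
  have kn23 : K (-2) 3 = ζ ^ 3 * K 2 2 := by
    have h := hleft (-2) 3
    have h' := hright 3 (-2)
    norm_num at h h'
    rw [← k3n2, ← neg_neg (K (-2) 3), ← h, h', neg_neg]
  norm_num at r₁ r₂ r₃ r₄ r₅ r₆
  simp only [kn1n2, kn1n1, kn10, kn11, kn12, kn2n2, kn2n1, kn21, kn22, k0n2, k04,
    k3n2, k30, k32, k4n2, k40, k42, k13, k23, kn13, kn23] at r₁ r₂ r₃ r₄ r₅ r₆ ⊢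
  linear_combination ζ ^ 3 * (K 0 2 * K 1 0 * r₁ - K 1 2 * K 2 2 * r₂ -
    K 0 2 * K 2 0 * r₃ + K 1 (-2) * K 2 2 * r₄ +
    K 1 2 * K 2 (-2) * r₅ - K 1 (-2) * K 2 (-2) * r₆) +
    (ζ ^ 2 * (K 1 1 * K 1 2 ^ 2 * K 2 2 * K 2 (-1) ^ 2 -
        K 1 1 * K 1 2 ^ 2 * K 2 1 ^ 2 * K 2 (-2)) -
      ζ * (K 1 2 * K 1 (-1) ^ 2 * K 2 1 * K 2 2 ^ 2 -
        K 1 1 ^ 2 * K 1 (-2) * K 2 1 * K 2 2 ^ 2)) * hζ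

theorem theta_identity_mixed (τ : ℂ) (hτ : 0 < τ.im) :
    (θ (1/5) (1/5) τ ^ 2 * θ (1/5) (3/5) τ - ζ₅ ^ 4 * θ (1/5) (9/5) τ ^ 2 * θ (1/5) (7/5) τ) * (ζ₅ * θ (3/5) (7/5) τ ^ 2 * θ (3/5) (1/5) τ - ζ₅ * θ (3/5) (3/5) τ ^ 2 * θ (3/5) (9/5) τ) = (θ (3/5) (1/5) τ ^ 2 * θ (3/5) (3/5) τ - ζ₅ ^ 2 * θ (3/5) (9/5) τ ^ 2 * θ (3/5) (7/5) τ) * (ζ₅ ^ 2 * θ (1/5) (7/5) τ ^ 2 * θ (1/5) (1/5) τ - ζ₅ ^ 2 * θ (1/5) (3/5) τ ^ 2 * θ (1/5) (9/5) τ) := by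
  have hpow (k : ℕ) : ζ₅ ^ k = Complex.exp (2 * Real.pi * Complex.I * k / 5) := by
    rw [ζ₅, ← Complex.exp_nat_mul]
    congr 1
    ring
  have hζ : ζ₅ ^ 5 = 1 := by
    rw [hpow, ← Complex.exp_two_pi_mul_I]
    congr 1
    push_cast
    ring
  have key := sextic_identity_of_three_term ζ₅ hζ (fun m n ↦ oddTheta (m / 5) (n / 5) τ)
    (fun m n ↦ by
      rw [← oddTheta_neg]
      congr 1 <;> (push_cast; ring))
    (fun m n ↦ by
      rw [← oddTheta_add_one_left]
      congr 1
      push_cast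
      ring)
    (fun m n ↦ by
      have h := oddTheta_add_one_right (m / 5) (n / 5) τ
      rw [show (n / 5 + 1 : ℝ) = (n + 5) / 5 by ring] at h
      rw [hpow]
      push_cast at h ⊢
      rw [h, mul_div_assoc])
    (fun b b' c c' d d' ↦ by
      have h := oddTheta_three_term (b / 5) (b' / 5) (c / 5) (c' / 5) (d / 5) (d' / 5) hτ
      push_cast
      simp only [add_div, sub_div]
      exact h)
  have hθ₁ (n : ℤ) : θ (1 / 5) (1 + 2 * (n / 5)) τ = Complex.exp (Real.pi * Complex.I * (-2 / 5)) *
      oddTheta ((-2 : ℤ) / 5) (n / 5) τ := by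
    rw [oddTheta, ← mul_assoc, ← Complex.exp_add]
    push_cast
    norm_num
  have hθ₃ (n : ℤ) : θ (3 / 5) (1 + 2 * (n / 5)) τ = Complex.exp (Real.pi * Complex.I * (-1 / 5)) *
      oddTheta ((-1 : ℤ) / 5) (n / 5) τ := by
    rw [oddTheta, ← mul_assoc, ← Complex.exp_add]
    push_cast
    norm_num
  rw [show (9 / 5 : ℝ) = 1 + 2 * ((2 : ℤ) / 5) by norm_num,
    show (7 / 5 : ℝ) = 1 + 2 * ((1 : ℤ) / 5) by norm_num,
    show θ (1 / 5) (3 / 5) τ = θ (1 / 5) (1 + 2 * ((-1 : ℤ) / 5)) τ by norm_num,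
    show θ (3 / 5) (3 / 5) τ = θ (3 / 5) (1 + 2 * ((-1 : ℤ) / 5)) τ by norm_num,
    show θ (1 / 5) (1 / 5) τ = θ (1 / 5) (1 + 2 * ((-2 : ℤ) / 5)) τ by norm_num,
    show θ (3 / 5) (1 / 5) τ = θ (3 / 5) (1 + 2 * ((-2 : ℤ) / 5)) τ by norm_num]
  simp only [hθ₁, hθ₃]
  linear_combination Complex.exp (Real.pi * Complex.I * (-2 / 5)) ^ 3 *
    Complex.exp (Real.pi * Complex.I * (-1 / 5)) ^ 3 * key
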